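/- Let s > 0 and ε ∈ (0,1). There exists a constant C = C(s, ε) such that for every integer N ≥ 2, every set X with |X| = N², and every family 𝒮 of N-element subsets of X with |𝒮| ≤ N^s, there exists a subset S' ⊆ X with |S'| = ⌈N^{1−ε}⌉ such that |S ∩ S'| ≤ C for every S ∈ 𝒮. -/

import Mathlib

open Finset in
/-- At most `(|X| - |T|).choose (m - |T|)` of the `m`-element subsets of `X` contain `T`. -/
theorem card_powersetCard_filter_superset_le {X : Type*} [Fintype X] [DecidableEq X]
    (T : Finset X) (m : ℕ) :
    (((univ : Finset X).powersetCard m).filter (T ⊆ ·)).card ≤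
      (Fintype.card X - T.card).choose (m - T.card) := by
  rw [← card_compl, ← card_powersetCard]
  refine card_le_card_of_injOn (· \ T) ?_ ?_
  · intro A hA
    simp only [coe_filter, mem_powersetCard, Set.mem_ofPred_eq] at hA
    simp only [mem_coe, mem_powersetCard]
    refine ⟨fun x hx => ?_, ?_⟩
    · simp only [mem_sdiff] at hx
      simpa using hx.2
    · rw [card_sdiff_of_subset hA.2, hA.1.2]
  · intro A hA B hB hAB
    simp only [coe_filter, Set.mem_ofPred_eq] at hA hB
    rw [← sdiff_union_of_subset hA.2, ← sdiff_union_of_subset hB.2]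
    exact congrArg (· ∪ T) hAB

theorem pow_mul_descFactorial_le {m n : ℕ} (h : m ≤ n) (k : ℕ) :
    n ^ k * m.descFactorial k ≤ m ^ k * n.descFactorial k := by
  induction k with
  | zero => simp
  | succ k ih =>
    have h1 : n * (m - k) ≤ m * (n - k) := by
      rw [Nat.mul_sub, Nat.mul_sub, Nat.mul_comm n m]
      exact Nat.sub_le_sub_left (Nat.mul_le_mul_right k h) _
    rw [Nat.descFactorial_succ, Nat.descFactorial_succ]
    calc n ^ (k + 1) * ((m - k) * m.descFactorial k)
        = (n * (m - k)) * (n ^ k * m.descFactorial k) := by ring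
      _ ≤ (m * (n - k)) * (m ^ k * n.descFactorial k) := Nat.mul_le_mul h1 ih
      _ = _ := by ring

theorem pow_mul_choose_le {m n : ℕ} (h : m ≤ n) (k : ℕ) :
    n ^ k * m.choose k ≤ m ^ k * n.choose k := by
  have h1 := pow_mul_descFactorial_le h k
  rw [Nat.descFactorial_eq_factorial_mul_choose, Nat.descFactorial_eq_factorial_mul_choose] at h1
  refine Nat.le_of_mul_le_mul_left ?_ k.factorial_pos
  linarith

open Finset in
/-- First-moment bound: a family of `N`-sets that is small compared with the binomial
coefficients admits an `m`-set meeting each member in fewer than `k` points. -/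
theorem exists_card_eq_forall_card_inter_lt {X : Type*} [Fintype X] [DecidableEq X]
    (𝒮 : Finset (Finset X)) {N m k : ℕ} (h𝒮 : ∀ S ∈ 𝒮, S.card = N) (hkm : k ≤ m)
    (hmX : m ≤ Fintype.card X)
    (h : 𝒮.card * N.choose k * m.choose k < (Fintype.card X).choose k) :
    ∃ A : Finset X, A.card = m ∧ ∀ S ∈ 𝒮, (S ∩ A).card < k := by
  set n := Fintype.card X with hn
  let bad : Finset (Finset X) := 𝒮.biUnion fun S => (S.powersetCard k).biUnion fun T =>
    ((univ : Finset X).powersetCard m).filter (T ⊆ ·)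
  have hbad : bad.card ≤ 𝒮.card * (N.choose k * (n - k).choose (m - k)) := by
    refine card_biUnion_le_card_mul _ _ _ fun S hS => ?_
    rw [← h𝒮 S hS, ← card_powersetCard]
    refine card_biUnion_le_card_mul _ _ _ fun T hT => ?_
    have := card_powersetCard_filter_superset_le T m
    rwa [(mem_powersetCard.1 hT).2] at this
  have hlt : bad.card < ((univ : Finset X).powersetCard m).card := by
    rw [card_powersetCard, card_univ, ← hn]
    refine hbad.trans_lt ?_
    have hpos : 0 < (n - k).choose (m - k) := Nat.choose_pos (by omega)
    refine Nat.lt_of_mul_lt_mul_right (a := m.choose k) ?_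
    rw [Nat.choose_mul hkm]
    calc _ = 𝒮.card * N.choose k * m.choose k * (n - k).choose (m - k) := by ring
      _ < _ := Nat.mul_lt_mul_of_pos_right h hpos
  obtain ⟨A, hA, hAbad⟩ := exists_mem_notMem_of_card_lt_card hlt
  refine ⟨A, (mem_powersetCard.1 hA).2, fun S hS => ?_⟩
  by_contra! hk
  obtain ⟨T, hT, hTk⟩ := exists_subset_card_eq hk
  refine hAbad (mem_biUnion.2 ⟨S, hS, mem_biUnion.2 ⟨T, mem_powersetCard.2
    ⟨hT.trans inter_subset_left, hTk⟩, mem_filter.2 ⟨hA, hT.trans inter_subset_right⟩⟩⟩)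

theorem two_pow_lt_factorial {k : ℕ} (hk : 4 ≤ k) : 2 ^ k < k.factorial := by
  induction k, hk using Nat.le_induction with
  | base => decide
  | succ k hk ih =>
    rw [pow_succ, Nat.factorial_succ, mul_comm]
    exact Nat.mul_lt_mul_of_le_of_lt (by omega) ih (by omega)


/-- For `s > 0` and `ε ∈ (0,1)` there is `C = C(s,ε)` such that for every
`N ≥ 2`, every set `X` with `|X| = N²` and every family `𝒮` of `N`-element subsets of `X`
with `|𝒮| ≤ N^s`, there is `S' ⊆ X` with `|S'| = ⌈N^(1−ε)⌉` and `|S ∩ S'| ≤ C` for all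
`S ∈ 𝒮`. -/
theorem stmt2 (s ε : ℝ) (hs : 0 < s) (hε0 : 0 < ε) (hε1 : ε < 1) :
    ∃ C : ℝ, ∀ N : ℕ, 2 ≤ N →
      ∀ (X : Type) [Fintype X] [DecidableEq X] (𝒮 : Finset (Finset X)),
        Fintype.card X = N ^ 2 →
        (∀ S ∈ 𝒮, S.card = N) →
        (𝒮.card : ℝ) ≤ (N : ℝ) ^ s →
        ∃ S' : Finset X, S'.card = ⌈(N : ℝ) ^ (1 - ε)⌉₊ ∧
          ∀ S ∈ 𝒮, ((S ∩ S').card : ℝ) ≤ C := by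
  obtain ⟨k₀, hk₀⟩ := exists_nat_ge (s / ε)
  let k := max k₀ 4
  have hsk : s ≤ ε * k := by
    have h1 : s / ε ≤ k := hk₀.trans (by exact_mod_cast le_max_left k₀ 4)
    rwa [div_le_iff₀ hε0, mul_comm] at h1
  have hfac : 2 ^ k < k.factorial := two_pow_lt_factorial (le_max_right _ _)
  refine ⟨k, fun N hN X _ _ 𝒮 hX h𝒮 hcard => ?_⟩
  have hN1 : (1 : ℝ) ≤ N := by exact_mod_cast (by omega : 1 ≤ N)
  have hN0 : (0 : ℝ) < N := by linarith
  set m := ⌈(N : ℝ) ^ (1 - ε)⌉₊ with hm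
  have hmN : m ≤ N := by
    rw [hm, Nat.ceil_le]
    exact Real.rpow_le_self_of_one_le hN1 (by linarith)
  have hmX : m ≤ N ^ 2 := hmN.trans (Nat.le_self_pow two_ne_zero N)
  rcases lt_or_ge m k with hmk | hkm
  · obtain ⟨A, -, hA⟩ := Finset.exists_subset_card_eq
      (s := (Finset.univ : Finset X)) (n := m) (by rwa [Finset.card_univ, hX])
    refine ⟨A, hA, fun S _ => ?_⟩
    exact_mod_cast (Finset.card_le_card Finset.inter_subset_right).trans (hA.le.trans hmk.le)
  have hm2 : (m : ℝ) * (N : ℝ) ^ ε ≤ 2 * N := by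
    have h1 : (1 : ℝ) ≤ (N : ℝ) ^ (1 - ε) := Real.one_le_rpow hN1 (by linarith)
    have h2 : (m : ℝ) < (N : ℝ) ^ (1 - ε) + 1 := Nat.ceil_lt_add_one (by linarith)
    calc (m : ℝ) * (N : ℝ) ^ ε ≤ (2 * (N : ℝ) ^ (1 - ε)) * (N : ℝ) ^ ε := by
          gcongr
          linarith
      _ = 2 * N := by
          rw [mul_assoc, ← Real.rpow_add hN0, sub_add_cancel, Real.rpow_one]
  have hfamily : 𝒮.card * m ^ k ≤ (2 * N) ^ k := by
    have h1 : (𝒮.card : ℝ) ≤ ((N : ℝ) ^ ε) ^ k := by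
      rw [← Real.rpow_mul_natCast hN0.le]
      exact hcard.trans (Real.rpow_le_rpow_of_exponent_le hN1 hsk)
    have h2 : (𝒮.card : ℝ) * (m : ℝ) ^ k ≤ (2 * (N : ℝ)) ^ k :=
      calc (𝒮.card : ℝ) * (m : ℝ) ^ k ≤ ((N : ℝ) ^ ε) ^ k * (m : ℝ) ^ k := by gcongr
        _ = ((m : ℝ) * (N : ℝ) ^ ε) ^ k := by rw [mul_pow, mul_comm]
        _ ≤ _ := by gcongr
    exact_mod_cast h2
  have hchoose : k.factorial * N.choose k ≤ N ^ k := by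
    rw [← Nat.descFactorial_eq_factorial_mul_choose]
    exact Nat.descFactorial_le_pow N k
  have hcount : 𝒮.card * N.choose k * m.choose k < (N ^ 2).choose k := by
    have hNk : 0 < N ^ k := pow_pos (by omega) k
    have hpos : 0 < (N ^ 2).choose k := Nat.choose_pos (hkm.trans hmX)
    refine Nat.lt_of_mul_lt_mul_left (a := k.factorial * (N ^ 2) ^ k) ?_
    calc k.factorial * (N ^ 2) ^ k * (𝒮.card * N.choose k * m.choose k)
        = 𝒮.card * (k.factorial * N.choose k) * ((N ^ 2) ^ k * m.choose k) := by ring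
      _ ≤ 𝒮.card * N ^ k * (m ^ k * (N ^ 2).choose k) := by
          exact Nat.mul_le_mul (Nat.mul_le_mul_left _ hchoose) (pow_mul_choose_le hmX k)
      _ = (𝒮.card * m ^ k) * (N ^ k * (N ^ 2).choose k) := by ring
      _ ≤ (2 * N) ^ k * (N ^ k * (N ^ 2).choose k) := by gcongr
      _ = 2 ^ k * (N ^ k * N ^ k * (N ^ 2).choose k) := by rw [mul_pow]; ring
      _ < k.factorial * (N ^ k * N ^ k * (N ^ 2).choose k) := by gcongr
      _ = _ := by ring
  obtain ⟨A, hA, hAS⟩ := exists_card_eq_forall_card_inter_lt 𝒮 h𝒮 hkm (hX ▸ hmX) (hX ▸ hcount)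
  exact ⟨A, hA, fun S hS => by exact_mod_cast (hAS S hS).le⟩
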